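/- Assume Γ is Q-polynomial with respect to E. Then for all vertices x, y ∈ X at distance ∂(x,y) = d: E x̂ ⋆ E ŷ = [ (θ*_{d-1} − θ*_d) E x⁻_y + (θ₁ − θ₂) θ*_d E x̂ + (θ₂ − θ₀) E ŷ ] / ( |X| (θ₁ − θ₂) ). -/

import Mathlib

open Matrix Finset
open scoped Classical

/-- A distance-regular graph `Γ` with vertex set `X`, path-length distance
`G.dist`, diameter `d ≥ 2`, and intersection numbers `p h i j`. -/
structure DRG where
  X : Type
  [fin : Fintype X]
  [deceq : DecidableEq X]
  G : SimpleGraph X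
  conn : G.Connected
  d : ℕ
  d_ge_two : 2 ≤ d
  dist_le : ∀ x y : X, G.dist x y ≤ d
  dist_attained : ∃ x y : X, G.dist x y = d
  p : ℕ → ℕ → ℕ → ℕ
  dist_regular : ∀ (h i j : ℕ) (x y : X), G.dist x y = h →
    (Finset.univ.filter fun z => G.dist x z = i ∧ G.dist y z = j).card = p h i j

attribute [instance] DRG.fin DRG.deceq

namespace DRG

variable (Γ : DRG)

/-- `Γ_i(x) = {z : ∂(x,z) = i}`. -/
noncomputable def sphere (x : Γ.X) (i : ℕ) : Finset Γ.X :=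
  Finset.univ.filter fun z => Γ.G.dist x z = i

/-- The number of vertices `|X|`, as a real number. -/
noncomputable def n : ℝ := (Fintype.card Γ.X : ℝ)

/-- The `i`-th distance matrix `A_i`. -/
noncomputable def Ai (i : ℕ) : Matrix Γ.X Γ.X ℝ :=
  Matrix.of fun x y => if Γ.G.dist x y = i then (1 : ℝ) else 0

/-- The adjacency matrix `A = A_1`. -/
noncomputable def A : Matrix Γ.X Γ.X ℝ := Γ.Ai 1

/-- The all-ones matrix `J`. -/
def Jmat : Matrix Γ.X Γ.X ℝ := Matrix.of fun _ _ => (1 : ℝ)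

/-- `c_i = p^i_{1,i-1}` (so `c_0 = 0`). -/
noncomputable def c (i : ℕ) : ℝ := (Γ.p i 1 (i - 1) : ℝ)

/-- `a_i = p^i_{1,i}`. -/
noncomputable def a (i : ℕ) : ℝ := (Γ.p i 1 i : ℝ)

/-- `b_i = p^i_{1,i+1}` (so `b_d = 0`). -/
noncomputable def b (i : ℕ) : ℝ := (Γ.p i 1 (i + 1) : ℝ)

/-- The standard basis vector `x̂`. -/
noncomputable def hatv (x : Γ.X) : Γ.X → ℝ := Pi.single x 1

/-- `x⁺_y = Σ_{z ∈ Γ(x) ∩ Γ_{i+1}(y)} ẑ` where `i = ∂(x,y)`. -/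
noncomputable def plusv (x y : Γ.X) : Γ.X → ℝ :=
  ∑ z ∈ Γ.sphere x 1 ∩ Γ.sphere y (Γ.G.dist x y + 1), Γ.hatv z

/-- `x⁰_y = Σ_{z ∈ Γ(x) ∩ Γ_i(y)} ẑ` where `i = ∂(x,y)`. -/
noncomputable def zerov (x y : Γ.X) : Γ.X → ℝ :=
  ∑ z ∈ Γ.sphere x 1 ∩ Γ.sphere y (Γ.G.dist x y), Γ.hatv z

/-- `x⁻_y = Σ_{z ∈ Γ(x) ∩ Γ_{i-1}(y)} ẑ` where `i = ∂(x,y)`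
(for `i = 0` this is the zero vector, matching `Γ_{-1}(y) = ∅`). -/
noncomputable def minusv (x y : Γ.X) : Γ.X → ℝ :=
  ∑ z ∈ Γ.sphere x 1 ∩ Γ.sphere y (Γ.G.dist x y - 1), Γ.hatv z

/-- The Norton product `u ⋆ v = E (u ∘ v)`, where `∘` is the entrywise
(Hadamard) product of vectors. -/
noncomputable def norton (E : Matrix Γ.X Γ.X ℝ) (u v : Γ.X → ℝ) : Γ.X → ℝ :=
  E *ᵥ (u * v)

/-- `E 0, …, E d` is the sequence of primitive idempotents of the Bose–Mesner
algebra, with `E 0 = |X|⁻¹ J`, and `θ 0, …, θ d` are the corresponding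
(mutually distinct) eigenvalues, so that `A = Σ_i θ i • E i`. -/
def IsPrimIdemSeq (E : ℕ → Matrix Γ.X Γ.X ℝ) (θ : ℕ → ℝ) : Prop :=
  E 0 = (Γ.n)⁻¹ • Γ.Jmat ∧
  ∑ i ∈ Finset.range (Γ.d + 1), E i = 1 ∧
  (∀ i j : ℕ, i ≤ Γ.d → j ≤ Γ.d → E i * E j = if i = j then E i else 0) ∧
  Γ.A = ∑ i ∈ Finset.range (Γ.d + 1), θ i • E i ∧
  (∀ i j : ℕ, i ≤ Γ.d → j ≤ Γ.d → θ i = θ j → i = j)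

/-- `q h i j` are the Krein parameters:
`E i ∘ E j = |X|⁻¹ Σ_h q h i j • E h`, with `∘` the entrywise product. -/
def IsKrein (E : ℕ → Matrix Γ.X Γ.X ℝ) (q : ℕ → ℕ → ℕ → ℝ) : Prop :=
  ∀ i j : ℕ, i ≤ Γ.d → j ≤ Γ.d →
    Matrix.hadamard (E i) (E j) =
      (Γ.n)⁻¹ • ∑ h ∈ Finset.range (Γ.d + 1), q h i j • E h

/-- The ordering `E 1, …, E d` is `Q`-polynomial: for `0 ≤ h,i,j ≤ d`,
`q h i j = 0` if one of `h,i,j` is greater than the sum of the other two, and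
`q h i j ≠ 0` if one of `h,i,j` equals the sum of the other two. -/
def IsQPolynomial (q : ℕ → ℕ → ℕ → ℝ) : Prop :=
  ∀ h i j : ℕ, h ≤ Γ.d → i ≤ Γ.d → j ≤ Γ.d →
    ((i + j < h ∨ h + j < i ∨ h + i < j) → q h i j = 0) ∧
    ((h = i + j ∨ i = h + j ∨ j = h + i) → q h i j ≠ 0)

/-- `ts 0, …, ts d` are the (mutually distinct) dual eigenvalues associated
with `E`, i.e. `E = |X|⁻¹ Σ_i ts i • A i`.  The values `ts (-1)` and
`ts (d+1)` are arbitrary reals (indeterminates). -/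
def IsDualEigs (E : Matrix Γ.X Γ.X ℝ) (ts : ℤ → ℝ) : Prop :=
  E = (Γ.n)⁻¹ • ∑ i ∈ Finset.range (Γ.d + 1), ts i • Γ.Ai i

/-- The dual eigenvalues `ts 0, …, ts d` are mutually distinct. -/
def DualDistinct (ts : ℤ → ℝ) : Prop :=
  ∀ i j : ℕ, i ≤ Γ.d → j ≤ Γ.d → ts i = ts j → i = j

/-- `C(x,y) = E x⁻_y − c_i ((θ*_1 − θ*_{i-1})/(θ*_0 − θ*_i)) E x̂`,
where `i = ∂(x,y)`. -/
noncomputable def Cvec (E : Matrix Γ.X Γ.X ℝ) (ts : ℤ → ℝ) (x y : Γ.X) :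
    Γ.X → ℝ :=
  E *ᵥ Γ.minusv x y -
    (Γ.c (Γ.G.dist x y) *
      ((ts 1 - ts ((Γ.G.dist x y : ℤ) - 1)) / (ts 0 - ts (Γ.G.dist x y)))) •
      (E *ᵥ Γ.hatv x)

/-- `B(x,y) = E x⁺_y − b_i ((θ*_1 − θ*_{i+1})/(θ*_0 − θ*_i)) E x̂`,
where `i = ∂(x,y)`. -/
noncomputable def Bvec (E : Matrix Γ.X Γ.X ℝ) (ts : ℤ → ℝ) (x y : Γ.X) :
    Γ.X → ℝ :=
  E *ᵥ Γ.plusv x y -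
    (Γ.b (Γ.G.dist x y) *
      ((ts 1 - ts ((Γ.G.dist x y : ℤ) + 1)) / (ts 0 - ts (Γ.G.dist x y)))) •
      (E *ᵥ Γ.hatv x)

end DRG

namespace DRG

/-- The triple-product sum of squares expressed through Gram matrices. -/
lemma sum_sq_triple_product {ι : Type*} [Fintype ι] (P Q R : Matrix ι ι ℝ) :
    ∑ a, ∑ b, ∑ c, (∑ w, P w a * Q w b * R w c) ^ 2 =
      ∑ w, ∑ w', (P * Pᵀ) w w' * (Q * Qᵀ) w w' * (R * Rᵀ) w w' := by
  have expand (w w' : ι) : (P * Pᵀ) w w' * (Q * Qᵀ) w w' * (R * Rᵀ) w w' =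
      ∑ a, ∑ b, ∑ c, (P w a * Q w b * R w c) * (P w' a * Q w' b * R w' c) := by
    simp only [Matrix.mul_apply, Matrix.transpose_apply]
    rw [Finset.sum_mul_sum]
    simp only [Finset.sum_mul]
    simp only [Finset.mul_sum]
    exact Finset.sum_congr rfl fun a _ => Finset.sum_congr rfl fun b _ =>
      Finset.sum_congr rfl fun c _ => by ring
  simp only [expand, sq, Finset.sum_mul_sum]
  simp only [← Fintype.sum_prod_type']
  simpa [Fintype.sum_prod_type] using
    (Equiv.prodComm (ι × ι × ι) (ι × ι)).sum_comp fun t =>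
    (P t.1.1 t.2.1 * Q t.1.1 t.2.2.1 * R t.1.1 t.2.2.2) *
      (P t.1.2 t.2.1 * Q t.1.2 t.2.2.1 * R t.1.2 t.2.2.2)

variable {Γ : DRG} {E : ℕ → Matrix Γ.X Γ.X ℝ} {θ : ℕ → ℝ}

lemma n_ne_zero (Γ : DRG) : Γ.n ≠ 0 := by
  have := Γ.conn.nonempty
  exact Nat.cast_ne_zero.mpr Fintype.card_ne_zero

lemma A_apply (w x : Γ.X) : Γ.A w x = if Γ.G.dist w x = 1 then 1 else 0 := rfl

lemma A_transpose (Γ : DRG) : Γ.Aᵀ = Γ.A := by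
  ext w x
  simp [A_apply, SimpleGraph.dist_comm]

lemma IsPrimIdemSeq.mul_A (hE : Γ.IsPrimIdemSeq E θ) {j : ℕ} (hj : j ≤ Γ.d) :
    E j * Γ.A = θ j • E j := by
  obtain ⟨-, -, horth, hA, -⟩ := hE
  rw [hA, Finset.mul_sum, Finset.sum_eq_single_of_mem j (by simp; omega)]
  · simp [horth j j hj hj]
  · intro k hk hkj
    simp [horth j k hj (by simp at hk; omega), hkj.symm]

lemma IsPrimIdemSeq.transpose_eq (hE : Γ.IsPrimIdemSeq E θ) {h : ℕ} (hh : h ≤ Γ.d) :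
    (E h)ᵀ = E h := by
  have hAt : Γ.A * (E h)ᵀ = θ h • (E h)ᵀ := by
    simpa [Matrix.transpose_mul, A_transpose] using congrArg Matrix.transpose (hE.mul_A hh)
  have hzero (j : ℕ) (hj : j ≤ Γ.d) (hjh : j ≠ h) : E j * (E h)ᵀ = 0 := by
    have h₁ : θ j • (E j * (E h)ᵀ) = θ h • (E j * (E h)ᵀ) := by
      rw [← Matrix.smul_mul, ← hE.mul_A hj, Matrix.mul_assoc, hAt, Matrix.mul_smul]
    rw [← sub_eq_zero, ← sub_smul, smul_eq_zero, sub_eq_zero] at h₁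
    exact h₁.resolve_left fun heq => hjh (hE.2.2.2.2 j h hj hh heq)
  have hgram : (E h)ᵀ = E h * (E h)ᵀ := by
    conv_lhs => rw [← Matrix.one_mul (E h)ᵀ, ← hE.2.1, Finset.sum_mul]
    exact Finset.sum_eq_single_of_mem h (by simp; omega) fun k hk hkh =>
      hzero k (by simp at hk; omega) hkh
  calc (E h)ᵀ = E h * (E h)ᵀ := hgram
    _ = (E h * (E h)ᵀ)ᵀ := by simp [Matrix.transpose_mul]
    _ = E h := by rw [← hgram, Matrix.transpose_transpose]

/-- A vanishing Krein parameter forces the corresponding triple products to vanish. -/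
lemma IsPrimIdemSeq.triple_product_eq_zero (hE : Γ.IsPrimIdemSeq E θ) {q : ℕ → ℕ → ℕ → ℝ}
    (hq : Γ.IsKrein E q) {h i j : ℕ} (hh : h ≤ Γ.d) (hi : i ≤ Γ.d) (hj : j ≤ Γ.d)
    (h0 : q h i j = 0) (u v x : Γ.X) :
    ∑ w, E i w u * E j w v * E h w x = 0 := by
  have gram {k : ℕ} (hk : k ≤ Γ.d) : E k * (E k)ᵀ = E k := by
    rw [hE.transpose_eq hk, hE.2.2.1 k k hk hk, if_pos rfl]
  have htrace : ∑ w, ∑ w', E i w w' * E j w w' * E h w w' = 0 := by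
    have : (E i ⊙ E j) * (E h)ᵀ = 0 := by
      rw [hq i j hi hj, Matrix.smul_mul, Finset.sum_mul, hE.transpose_eq hh,
        Finset.sum_eq_zero, smul_zero]
      intro k hk
      rw [Matrix.smul_mul, hE.2.2.1 k h (by simp at hk; omega) hh]
      split_ifs with hkh
      · rw [hkh, h0, zero_smul]
      · exact smul_zero _
    simpa [Matrix.trace, Matrix.mul_apply] using congrArg Matrix.trace this
  have hsq := sum_sq_triple_product (E i) (E j) (E h)
  rw [gram hi, gram hj, gram hh, htrace] at hsq
  rw [Finset.sum_eq_zero_iff_of_nonneg fun _ _ => by positivity] at hsq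
  have hsq := hsq u (Finset.mem_univ _)
  rw [Finset.sum_eq_zero_iff_of_nonneg fun _ _ => by positivity] at hsq
  have hsq := hsq v (Finset.mem_univ _)
  rw [Finset.sum_eq_zero_iff_of_nonneg fun _ _ => by positivity] at hsq
  exact pow_eq_zero_iff two_ne_zero |>.mp (hsq x (Finset.mem_univ _))

lemma IsDualEigs.apply {F : Matrix Γ.X Γ.X ℝ} {ts : ℤ → ℝ} (hts : Γ.IsDualEigs F ts)
    (w y : Γ.X) : F w y = (Γ.n)⁻¹ * ts (Γ.G.dist w y) := by
  have hd := Nat.lt_succ_of_le (Γ.dist_le w y)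
  rw [hts]
  simp [Matrix.sum_apply, Ai, hd]

lemma mulVec_hatv (M : Matrix Γ.X Γ.X ℝ) (x : Γ.X) : M *ᵥ Γ.hatv x = fun w => M w x := by
  ext w
  simp [hatv]

lemma minusv_apply (x y w : Γ.X) :
    Γ.minusv x y w =
      if Γ.G.dist x w = 1 ∧ Γ.G.dist y w = Γ.G.dist x y - 1 then 1 else 0 := by
  simp [minusv, hatv, sphere, Finset.sum_apply, Pi.single_apply]

/-- Splitting the neighbours of `x` by their distance to a vertex `y` at distance `d`. -/
lemma dual_mul_A_hatv {ts : ℤ → ℝ} {x y : Γ.X} (hxy : Γ.G.dist x y = Γ.d) :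
    (fun w => ts (Γ.G.dist w y) * Γ.A w x) =
      (ts ((Γ.d : ℤ) - 1) - ts Γ.d) • Γ.minusv x y + ts Γ.d • (Γ.A *ᵥ Γ.hatv x) := by
  ext w
  have htri := Γ.conn.dist_triangle (u := x) (v := w) (w := y)
  have hle := Γ.dist_le w y
  have hd := Γ.d_ge_two
  simp only [mulVec_hatv, A_apply, minusv_apply, Pi.add_apply, Pi.smul_apply, smul_eq_mul, hxy,
    Γ.G.dist_comm (u := w) (v := x), Γ.G.dist_comm (u := y) (v := w)]
  by_cases hxw : Γ.G.dist x w = 1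
  · rcases (by omega : Γ.G.dist w y = Γ.d - 1 ∨ Γ.G.dist w y = Γ.d) with hw | hw
    · simp [hxw, hw, Nat.cast_sub (by omega : 1 ≤ Γ.d)]
    · simp [hxw, hw, show Γ.d ≠ Γ.d - 1 by omega]
  · simp [hxw]

end DRG

/-- Corollary 3.8(iii): the `i = d` case. -/
theorem DRG.norton_product_dist_d (Γ : DRG) (E : ℕ → Matrix Γ.X Γ.X ℝ) (θ : ℕ → ℝ)
    (hE : Γ.IsPrimIdemSeq E θ)
    (q : ℕ → ℕ → ℕ → ℝ) (hq : Γ.IsKrein E q) (hQ : Γ.IsQPolynomial q)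
    (ts : ℤ → ℝ) (hts : Γ.IsDualEigs (E 1) ts) (hts' : Γ.DualDistinct ts) (x y : Γ.X)
    (hxy : Γ.G.dist x y = Γ.d) :
    Γ.norton (E 1) (E 1 *ᵥ Γ.hatv x) (E 1 *ᵥ Γ.hatv y) =
      (Γ.n * (θ 1 - θ 2))⁻¹ •
        ((ts ((Γ.d : ℤ) - 1) - ts (Γ.d : ℤ)) • (E 1 *ᵥ Γ.minusv x y) +
          ((θ 1 - θ 2) * ts (Γ.d : ℤ)) • (E 1 *ᵥ Γ.hatv x) +
          (θ 2 - θ 0) • (E 1 *ᵥ Γ.hatv y)) := by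
  have hd := Γ.d_ge_two
  have hn := Γ.n_ne_zero
  have h1 : 1 ≤ Γ.d := by omega
  have hθ : θ 1 - θ 2 ≠ 0 := sub_ne_zero.mpr fun h => by
    simpa using hE.2.2.2.2 1 2 h1 hd h
  let F : ℕ → Γ.X → ℝ := fun h => E 1 *ᵥ fun w => E 1 w y * E h w x
  have hFzero (h : ℕ) (hh : h ≤ Γ.d) (h2 : 2 < h) : F h = 0 := by
    ext u
    have := hE.triple_product_eq_zero hq hh h1 h1 ((hQ h 1 1 hh h1 h1).1 (by omega)) u y x
    rw [Pi.zero_apply, ← this]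
    refine Finset.sum_congr rfl fun w _ => ?_
    have hsymm : E 1 u w = E 1 w u := congrFun₂ (hE.transpose_eq h1) w u
    simp only [hsymm, mul_assoc]
  have hFlin (r : ℕ → ℝ) : ∑ h ∈ Finset.range (Γ.d + 1), r h • F h =
      E 1 *ᵥ fun w => E 1 w y * (∑ h ∈ Finset.range (Γ.d + 1), r h • E h) w x := by
    simp only [F, ← Matrix.mulVec_smul, ← Matrix.mulVec_sum]
    congr 1
    ext w
    simp only [Finset.sum_apply, Matrix.sum_apply, Finset.mul_sum, Pi.smul_apply,
      Matrix.smul_apply, smul_eq_mul]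
    exact Finset.sum_congr rfl fun h _ => by ring
  have hFA : ∑ h ∈ Finset.range (Γ.d + 1), θ h • F h =
      (Γ.n)⁻¹ • ((ts ((Γ.d : ℤ) - 1) - ts Γ.d) • (E 1 *ᵥ Γ.minusv x y) +
        (θ 1 * ts Γ.d) • (E 1 *ᵥ Γ.hatv x)) := by
    rw [hFlin, ← hE.2.2.2.1]
    have : (fun w => E 1 w y * Γ.A w x) =
        (Γ.n)⁻¹ • fun w => ts (Γ.G.dist w y) * Γ.A w x := by
      ext w
      simp [hts.apply, mul_assoc]
    rw [this, dual_mul_A_hatv hxy, Matrix.mulVec_smul, Matrix.mulVec_add, Matrix.mulVec_smul,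
      Matrix.mulVec_smul, Matrix.mulVec_mulVec, hE.mul_A h1, Matrix.smul_mulVec, smul_smul,
      mul_comm (ts _)]
  have hF1 : ∑ h ∈ Finset.range (Γ.d + 1), F h = ((Γ.n)⁻¹ * ts Γ.d) • (E 1 *ᵥ Γ.hatv x) := by
    have h := hFlin fun _ => 1
    simp only [one_smul, hE.2.1] at h
    rw [h, ← Matrix.mulVec_smul]
    congr 1
    ext w
    by_cases hw : w = x
    · simp [hw, hts.apply, hxy, DRG.hatv, Matrix.one_apply]
    · simp [hw, DRG.hatv]
  have hF0 : F 0 = (Γ.n)⁻¹ • (E 1 *ᵥ Γ.hatv y) := by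
    have hcol : (fun w => E 1 w y * E 0 w x) = (Γ.n)⁻¹ • (E 1 *ᵥ Γ.hatv y) := by
      ext w
      simp [hE.1, DRG.mulVec_hatv, DRG.Jmat, mul_comm]
    simp only [F]
    rw [hcol, Matrix.mulVec_smul, Matrix.mulVec_mulVec, hE.2.2.1 1 1 h1 h1, if_pos rfl]
  have hnorton : Γ.norton (E 1) (E 1 *ᵥ Γ.hatv x) (E 1 *ᵥ Γ.hatv y) = F 1 := by
    simp only [DRG.norton, DRG.mulVec_hatv, F]
    congr 1
    ext w
    exact mul_comm _ _
  have hthree : ∑ h ∈ Finset.range (Γ.d + 1), (θ h - θ 2) • F h =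
      (θ 0 - θ 2) • F 0 + (θ 1 - θ 2) • F 1 := by
    rw [← Finset.sum_subset (Finset.range_subset_range.mpr (by omega : 3 ≤ Γ.d + 1))]
    · simp [Finset.sum_range_succ]
    · intro h hh hh3
      rw [hFzero h (by simp at hh; omega) (by simp at hh3; omega), smul_zero]
  simp only [sub_smul _ (θ 2), Finset.sum_sub_distrib, ← Finset.smul_sum, hFA, hF1, hF0]
    at hthree
  rw [hnorton]
  ext u
  have hu := congrFun hthree u
  simp only [Pi.add_apply, Pi.sub_apply, Pi.smul_apply, smul_eq_mul] at hu ⊢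
  field_simp at hu ⊢
  linear_combination -hu
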